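/- arXiv:2502.08046 — 2 statements merged into one kernel-verified Lean document; each statement's English description precedes it below -/
import Mathlib

section
/- Fix r = 3. If m → ∞ and d = d(m) is a sequence of nonnegative integers with d = o(m), then H_3(d,m) = (1+o(1))·Ĥ_3(d,m). -/
open Filter Asymptotics

/-- `Hcount r m d` is the number of `d`-regular `(r,r)`-graphs with classes of size `m`. -/
noncomputable def Hcount (r m d : ℕ) : ℕ :=
  Nat.card {E : Finset (Fin r → Fin m) //
    ∀ t : Fin r, ∀ v : Fin m, (E.filter (fun e => e t = v)).card = d}

/-- The heuristic estimate `Ĥ_r(d,m) = C(m^(r-1), d)^(r*m) / C(m^r, m*d)^(r-1)`. -/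
noncomputable def Hhat (r m d : ℕ) : ℝ :=
  (((m ^ (r - 1)).choose d : ℝ)) ^ (r * m) / (((m ^ r).choose (m * d) : ℝ)) ^ (r - 1)

section

open Finset

section Switching

variable {α β : Type*} [DecidableEq α]

/-- The permutations applied to the three columns by a switching. -/
def switchPerm (t : Fin 3) (z e p q : α) (s : Fin 3) : Equiv.Perm α :=
  if s = t then Equiv.swap z e * Equiv.swap p q
  else if s = t + 1 then Equiv.swap e p else Equiv.swap e q

/-- Exchange column `t` of the rows `z` and `e`, and mix the rows `e`, `p`, `q` so that each of
them receives its entries from three different rows. -/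
def switchRows (t : Fin 3) (z e p q : α) (F : α → Fin 3 → β) : α → Fin 3 → β :=
  fun j s => F (switchPerm t z e p q s j) s

variable {i z e p q : α} (t : Fin 3) (F : α → Fin 3 → β)

lemma switch_switch (h : [i, z, e, p, q].Nodup) :
    switchRows t z e p q (switchRows t z e p q F) = F := by
  funext j s
  have : switchPerm t z e p q s (switchPerm t z e p q s j) = j := by
    unfold switchPerm
    simp at h
    split_ifs
    · simp only [Equiv.Perm.mul_apply, Equiv.swap_apply_def]
      grind
    · simp
    · simp
  simp [switchRows, this]

lemma switchRows_apply_of_ne {j : α} (hz : j ≠ z) (he : j ≠ e) (hp : j ≠ p) (hq : j ≠ q) :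
    switchRows t z e p q F j = F j := by
  funext s
  simp only [switchRows, switchPerm]
  split_ifs <;> simp [Equiv.swap_apply_of_ne_of_ne, *]

lemma switch_z_self (h : [i, z, e, p, q].Nodup) : switchRows t z e p q F z t = F e t := by
  simp at h
  simp only [switchRows, switchPerm, if_true, Equiv.Perm.mul_apply, Equiv.swap_apply_def]
  grind

lemma switch_z_ne (h : [i, z, e, p, q].Nodup) {s : Fin 3} (hs : s ≠ t) :
    switchRows t z e p q F z s = F z s := by
  simp at h
  simp only [switchRows, switchPerm, if_neg hs]
  grind

lemma switch_e (h : [i, z, e, p, q].Nodup) :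
    switchRows t z e p q F e t = F z t ∧ switchRows t z e p q F e (t + 1) = F p (t + 1) ∧
      switchRows t z e p q F e (t + 2) = F q (t + 2) := by
  simp at h
  have h1 : t + 1 ≠ t := by revert t; decide
  have h2 : t + 2 ≠ t := by revert t; decide
  have h3 : t + 2 ≠ t + 1 := by revert t; decide
  simp only [switchRows, switchPerm, if_true, h1, h2, h3, if_false, Equiv.Perm.mul_apply,
    Equiv.swap_apply_def]
  grind

lemma switch_p (h : [i, z, e, p, q].Nodup) :
    switchRows t z e p q F p t = F q t ∧ switchRows t z e p q F p (t + 1) = F e (t + 1) ∧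
      switchRows t z e p q F p (t + 2) = F p (t + 2) := by
  simp at h
  have h1 : t + 1 ≠ t := by revert t; decide
  have h2 : t + 2 ≠ t := by revert t; decide
  have h3 : t + 2 ≠ t + 1 := by revert t; decide
  simp only [switchRows, switchPerm, if_true, h1, h2, h3, if_false, Equiv.Perm.mul_apply,
    Equiv.swap_apply_def]
  grind

lemma switch_q (h : [i, z, e, p, q].Nodup) :
    switchRows t z e p q F q t = F p t ∧ switchRows t z e p q F q (t + 1) = F q (t + 1) ∧
      switchRows t z e p q F q (t + 2) = F e (t + 2) := by
  simp at h
  have h1 : t + 1 ≠ t := by revert t; decide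
  have h2 : t + 2 ≠ t := by revert t; decide
  have h3 : t + 2 ≠ t + 1 := by revert t; decide
  simp only [switchRows, switchPerm, if_true, h1, h2, h3, if_false, Equiv.Perm.mul_apply,
    Equiv.swap_apply_def]
  grind

/-- The switching on the distinct rows `z` and `x`, all different from `i`, keeps the rows
indexed by `K` distinct. -/
def IsSwitchable (t : Fin 3) (K : Finset α) (i z : α) (F : α → Fin 3 → β) (x : α × α × α) : Prop :=
  [i, z, x.1, x.2.1, x.2.2].Nodup ∧ Set.InjOn (switchRows t z x.1 x.2.1 x.2.2 F) K

end Switching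

section Balanced

variable {α β : Type*} [Fintype α] [DecidableEq β]

/-- In each column `t`, every value occurs exactly `d` times. -/
def IsBalanced (d : ℕ) (F : α → Fin 3 → β) : Prop :=
  ∀ t v, #{i | F i t = v} = d

variable [DecidableEq α]

lemma isBalanced_switchRows {d : ℕ} {F : α → Fin 3 → β} (hF : IsBalanced d F) (t : Fin 3)
    (z e p q : α) : IsBalanced d (switchRows t z e p q F) := by
  intro s v
  rw [← hF s v]
  change #{j | F (switchPerm t z e p q s j) s = v} = #{j | F j s = v}
  exact Finset.card_equiv (switchPerm t z e p q s) fun j => by simp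

variable {i z e p q : α} (t : Fin 3) {F : α → Fin 3 → β} {d : ℕ} (hF : IsBalanced d F)
include hF

omit [DecidableEq α] in
lemma IsBalanced.card_pairs_eq :
    #{x : α × α | F x.1 t = F x.2 t} = Fintype.card α * d := by
  rw [← Finset.univ_product_univ, Finset.card_filter, Finset.sum_product]
  have h (a : α) : (∑ b, if F a t = F b t then 1 else 0) = d := by
    rw [← Finset.card_filter, ← hF t (F a t)]
    simp only [eq_comm]
  simp [h]

lemma IsBalanced.card_pairs_incident_le (a b c : Fin 3) (v : β) :
    #{x : α × α | ∃ l, F l a = v ∧ F x.1 b = F l b ∧ F x.2 c = F l c} ≤ d * (d * d) := by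
  have hsub : ({x : α × α | ∃ l, F l a = v ∧ F x.1 b = F l b ∧ F x.2 c = F l c} : Finset _) ⊆
      ({l | F l a = v} : Finset α).biUnion
        fun l => ({x | F x b = F l b} : Finset α) ×ˢ ({x | F x c = F l c} : Finset α) := by
    intro x
    simp
  calc _ ≤ _ := Finset.card_le_card hsub
    _ ≤ #{l | F l a = v} * (d * d) := Finset.card_biUnion_le_card_mul _ _ _ fun l _ => by
        rw [Finset.card_product, hF, hF]
    _ = _ := by rw [hF]

open Classical in
/-- Few choices of the auxiliary rows `p`, `q` are unsuitable for a switching. -/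
lemma IsBalanced.card_not_switchable_le {K : Finset α} (hK : Set.InjOn F K) (hz : z ∉ K)
    (hei : e ≠ i) (hez : e ≠ z) (hiz : i ≠ z) (hd : d * d ≤ Fintype.card α) (hd1 : 1 ≤ d) :
    #{x : α × α | ¬ IsSwitchable t K i z F (e, x)} ≤
      13 * (Fintype.card α * d) := by
  let fst (a : α) : Finset (α × α) := {a} ×ˢ univ
  let snd (a : α) : Finset (α × α) := univ ×ˢ {a}
  let inc (a b c : Fin 3) (v : β) : Finset (α × α) :=
    {x : α × α | ∃ l, F l a = v ∧ F x.1 b = F l b ∧ F x.2 c = F l c}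
  let S1 : Finset (α × α) := fst i ∪ fst z ∪ fst e ∪ snd i ∪ snd z ∪ snd e ∪ univ.diag
  let S2 : Finset (α × α) := inc t (t + 1) (t + 2) (F z t) ∪
    inc (t + 1) (t + 2) t (F e (t + 1)) ∪ inc (t + 2) t (t + 1) (F e (t + 2))
  let S3 : Finset (α × α) := ({x | F x (t + 1) = F e (t + 1)} : Finset α) ×ˢ univ ∪
    univ ×ˢ ({x | F x (t + 2) = F e (t + 2)} : Finset α) ∪
    ({x | F x.1 t = F x.2 t} : Finset (α × α))
  have hsub : ({x : α × α | ¬ IsSwitchable t K i z F (e, x)} : Finset _) ⊆ S1 ∪ S2 ∪ S3 := by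
    rintro ⟨p, q⟩ hx
    by_contra hS
    simp only [mem_filter, mem_univ, true_and] at hx
    have hnd : [i, z, e, p, q].Nodup := by
      simp [S1, fst, snd] at hS ⊢
      grind
    apply hx
    refine ⟨hnd, ?_⟩
    obtain ⟨e1, e2, e3⟩ := switch_e t F hnd
    obtain ⟨p1, p2, p3⟩ := switch_p t F hnd
    obtain ⟨q1, q2, q3⟩ := switch_q t F hnd
    simp only [S2, S3, inc, mem_union, mem_filter, mem_univ, true_and, mem_product, not_or,
      and_true, not_exists] at hS
    have hnew : ∀ j ∈ K, j = e ∨ j = p ∨ j = q ∨ switchRows t z e p q F j = F j := by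
      intro j hj
      by_cases he : j = e
      · tauto
      by_cases hp : j = p
      · tauto
      by_cases hq : j = q
      · tauto
      have hjz : j ≠ z := fun h => hz (h ▸ hj)
      exact .inr (.inr (.inr (switchRows_apply_of_ne t F hjz he hp hq)))
    intro k hk l hl hkl
    have ht := congrFun hkl t
    have hu := congrFun hkl (t + 1)
    have hw := congrFun hkl (t + 2)
    obtain ⟨⟨-, ⟨i1, i2⟩, i3⟩, ⟨i4, i5⟩, i6⟩ := hS
    generalize t + 1 = u at *
    generalize t + 2 = w at *
    rcases hnew k hk with rfl | rfl | rfl | hk' <;> rcases hnew l hl with rfl | rfl | rfl | hl' <;>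
      first
      | rfl
      | exact hK hk hl (hk'.symm.trans (hkl.trans hl'))
      | (exfalso; have hl'' := congrFun hl'; grind)
      | (exfalso; have hk'' := congrFun hk'; grind)
      | (exfalso; grind)
  have c1 : #S1 ≤ 7 * (Fintype.card α * d) := by
    have h1 (a : α) : #(fst a) = Fintype.card α := by simp [fst]
    have h2 (a : α) : #(snd a) = Fintype.card α := by simp [snd]
    have h3 : #(univ : Finset α).diag = Fintype.card α := by simp
    have h4 : Fintype.card α ≤ Fintype.card α * d := Nat.le_mul_of_pos_right _ hd1
    calc #S1 ≤ #(fst i) + #(fst z) + #(fst e) + #(snd i) + #(snd z) + #(snd e) +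
        #(univ : Finset α).diag := by
          iterate 6 refine (card_union_le _ _).trans (Nat.add_le_add_right ?_ _)
          rfl
      _ ≤ _ := by rw [h1, h1, h1, h2, h2, h2, h3]; omega
  have c2 : #S2 ≤ 3 * (Fintype.card α * d) := by
    have h (a b c : Fin 3) (v : β) : #(inc a b c v) ≤ Fintype.card α * d :=
      (hF.card_pairs_incident_le a b c v).trans (by nlinarith)
    refine (card_union_le _ _).trans ?_
    refine (Nat.add_le_add_right (card_union_le _ _) _).trans ?_
    have := h t (t + 1) (t + 2) (F z t)
    have := h (t + 1) (t + 2) t (F e (t + 1))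
    have := h (t + 2) t (t + 1) (F e (t + 2))
    omega
  have c3 : #S3 ≤ 3 * (Fintype.card α * d) := by
    refine (card_union_le _ _).trans ?_
    refine (Nat.add_le_add_right (card_union_le _ _) _).trans ?_
    rw [card_product, card_product, hF, hF, hF.card_pairs_eq, card_univ, mul_comm d]
    omega
  calc _ ≤ _ := card_le_card hsub
    _ ≤ _ := (card_union_le _ _).trans (Nat.add_le_add_right (card_union_le _ _) _)
    _ ≤ _ := by omega

end Balanced

section Counting

variable {α β : Type*} [Fintype α] [DecidableEq β] [DecidableEq α]

omit [DecidableEq β] in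
open Classical in
lemma card_switchable_le (t : Fin 3) (K : Finset α) (i z : α) (F : α → Fin 3 → β) (R : α → Prop)
    [DecidablePred R] :
    #{x : α × α × α | IsSwitchable t K i z F x ∧ R x.1} ≤
      #{e | R e} * (Fintype.card α * Fintype.card α) := by
  calc _ ≤ #(({e | R e} : Finset α) ×ˢ (univ : Finset (α × α))) :=
        card_le_card fun x => by simp
    _ = _ := by simp

open Classical in
lemma IsBalanced.le_card_switchable {d : ℕ} {F : α → Fin 3 → β} (hF : IsBalanced d F) (t : Fin 3)
    {K : Finset α} (hK : Set.InjOn F K) {i z : α} (hz : z ∉ K) (hiz : i ≠ z)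
    (hd : d * d ≤ Fintype.card α) (hd1 : 1 ≤ d) (R : α → Prop)
    [DecidablePred R] :
    #{e | R e} * (Fintype.card α * Fintype.card α) ≤
      #{x : α × α × α | IsSwitchable t K i z F x ∧ R x.1} +
        2 * (Fintype.card α * Fintype.card α) + #{e | R e} * (13 * (Fintype.card α * d)) := by
  have hsub : ({e | R e} : Finset α) ×ˢ (univ : Finset (α × α)) ⊆
      ({x : α × α × α | IsSwitchable t K i z F x ∧ R x.1} : Finset _) ∪
        ({i, z} : Finset α) ×ˢ (univ : Finset (α × α)) ∪
        ({e | R e ∧ e ≠ i ∧ e ≠ z} : Finset α).biUnion fun e =>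
          {e} ×ˢ ({y | ¬ IsSwitchable t K i z F (e, y)} : Finset (α × α)) := by
    rintro ⟨e, y⟩
    simp
    tauto
  have h := card_le_card hsub
  rw [card_product, card_univ, Fintype.card_prod] at h
  refine h.trans ((card_union_le _ _).trans (add_le_add ((card_union_le _ _).trans ?_) ?_))
  · rw [card_product, card_univ, Fintype.card_prod, card_pair hiz]
  · refine (card_biUnion_le_card_mul _ _ (13 * (Fintype.card α * d)) fun e he => ?_).trans
      (Nat.mul_le_mul_right _ (card_le_card fun e => by simp +contextual))
    simp only [mem_filter, mem_univ, true_and] at he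
    rw [card_product, card_singleton, one_mul]
    exact hF.card_not_switchable_le t hK hz he.2.1 he.2.2 hiz hd hd1

variable [Fintype β]

open Classical in
/-- The balanced arrays whose rows indexed by `K` are distinct. -/
noncomputable def arrays (β : Type*) [Fintype β] [DecidableEq β] (d : ℕ) (K : Finset α) :
    Finset (α → Fin 3 → β) :=
  {F | IsBalanced d F ∧ Set.InjOn F K}

lemma mem_arrays {d : ℕ} {K : Finset α} {F : α → Fin 3 → β} :
    F ∈ arrays β d K ↔ IsBalanced d F ∧ Set.InjOn F K := by
  simp [arrays]

/-- The arrays in which the rows `z` and `i` agree in the columns of `T`. -/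
noncomputable def agreeing (β : Type*) [Fintype β] [DecidableEq β] (d : ℕ) (K : Finset α) (i z : α)
    (T : Finset (Fin 3)) : Finset (α → Fin 3 → β) :=
  {F ∈ arrays β d K | ∀ s ∈ T, F z s = F i s}

lemma mem_agreeing {d : ℕ} {K : Finset α} {i z : α} {T : Finset (Fin 3)} {F : α → Fin 3 → β} :
    F ∈ agreeing β d K i z T ↔
      (IsBalanced d F ∧ Set.InjOn F K) ∧ ∀ s ∈ T, F z s = F i s := by
  simp [agreeing, mem_arrays]

variable {d : ℕ} {K : Finset α} {i z : α} {T : Finset (Fin 3)} {t : Fin 3}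

open Classical in
lemma sum_card_switchable (ht : t ∉ T) :
    ∑ F ∈ agreeing β d K i z (insert t T), #{x | IsSwitchable t K i z F x ∧ True} =
      ∑ F ∈ agreeing β d K i z T, #{x | IsSwitchable t K i z F x ∧ F x.1 t = F i t} := by
  have h1 := sum_card_bipartiteAbove_eq_sum_card_bipartiteBelow (s := agreeing β d K i z (insert t T))
    (t := univ) fun F x => IsSwitchable t K i z F x ∧ True
  have h2 := sum_card_bipartiteAbove_eq_sum_card_bipartiteBelow (s := agreeing β d K i z T)
    (t := univ) fun F x => IsSwitchable t K i z F x ∧ F x.1 t = F i t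
  refine h1.trans (Eq.trans (sum_congr rfl ?_) h2.symm)
  rintro ⟨e, p, q⟩ -
  refine card_nbij' (switchRows t z e p q) (switchRows t z e p q) ?_ ?_ ?_ ?_
  · intro F hF
    simp only [bipartiteBelow, coe_filter, Set.mem_ofPred_eq, mem_agreeing, mem_insert,
      forall_eq_or_imp, and_true] at hF ⊢
    unfold IsSwitchable at hF ⊢
    dsimp only at hF ⊢
    obtain ⟨⟨⟨hb, hK⟩, hzt, hT⟩, hnd, hinj⟩ := hF
    have hi : switchRows t z e p q F i = F i := by
      simp at hnd
      apply switchRows_apply_of_ne <;> tauto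
    have hnd' : [i, e, z, p, q].Nodup := by
      simp at hnd ⊢
      grind
    refine ⟨⟨⟨isBalanced_switchRows hb t z e p q, hinj⟩, fun s hs => ?_⟩, ⟨hnd, ?_⟩, ?_⟩
    · rw [hi, switch_z_ne t F hnd (fun h => ht (h ▸ hs)), hT s hs]
    · rwa [switch_switch t F hnd]
    · rw [hi, (switch_e t F hnd).1, hzt]
  · intro F hF
    simp only [bipartiteBelow, coe_filter, Set.mem_ofPred_eq, mem_agreeing, mem_insert,
      forall_eq_or_imp, and_true] at hF ⊢
    unfold IsSwitchable at hF ⊢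
    dsimp only at hF ⊢
    obtain ⟨⟨⟨hb, hK⟩, hT⟩, ⟨hnd, hinj⟩, het⟩ := hF
    have hi : switchRows t z e p q F i = F i := by
      simp at hnd
      apply switchRows_apply_of_ne <;> tauto
    refine ⟨⟨⟨isBalanced_switchRows hb t z e p q, hinj⟩, ?_, fun s hs => ?_⟩, hnd, ?_⟩
    · rw [hi, switch_z_self t F hnd, het]
    · rw [hi, switch_z_ne t F hnd (fun h => ht (h ▸ hs)), hT s hs]
    · rwa [switch_switch t F hnd]
  · intro F hF
    exact switch_switch t F (mem_filter.1 hF).2.1.1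
  · intro F hF
    exact switch_switch t F (mem_filter.1 hF).2.1.1

variable (hz : z ∉ K) (hi : i ∈ K) (hd : d * d ≤ Fintype.card α) (hd1 : 1 ≤ d)
include hz hi hd hd1

lemma card_agreeing_insert_mul_le {m : ℕ} (hm : Fintype.card α = m * d) (ht : t ∉ T) :
    (#(agreeing β d K i z (insert t T)) : ℝ) * (m - 15) ≤ #(agreeing β d K i z T) := by
  classical
  have hiz : i ≠ z := fun h => hz (h ▸ hi)
  set M := Fintype.card α with hM
  have hup : ∑ F ∈ agreeing β d K i z T, #{x | IsSwitchable t K i z F x ∧ F x.1 t = F i t} ≤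
      #(agreeing β d K i z T) * (d * (M * M)) := by
    rw [← smul_eq_mul]
    refine sum_le_card_nsmul _ _ _ fun F hF => ?_
    have := card_switchable_le t K i z F fun e => F e t = F i t
    rwa [(mem_agreeing.1 hF).1.1] at this
  have hlow : #(agreeing β d K i z (insert t T)) * (M * (M * M)) ≤
      ∑ F ∈ agreeing β d K i z (insert t T), (#{x | IsSwitchable t K i z F x ∧ True} +
        (2 * (M * M) + M * (13 * (M * d)))) := by
    rw [← smul_eq_mul]
    refine card_nsmul_le_sum _ _ _ fun F hF => ?_
    obtain ⟨⟨hb, hK⟩, -⟩ := mem_agreeing.1 hF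
    have := hb.le_card_switchable t hK hz hiz hd hd1 fun _ => True
    simpa [← hM, add_assoc] using this
  rw [sum_add_distrib, sum_card_switchable ht, sum_const, smul_eq_mul] at hlow
  have h := hlow.trans (Nat.add_le_add_right hup _)
  generalize #(agreeing β d K i z (insert t T)) = a at *
  generalize #(agreeing β d K i z T) = b at *
  have hMd : M * (13 * (M * d)) + 2 * (M * M) ≤ 15 * (M * M * d) := by nlinarith
  have hMpos : 0 < M := Fintype.card_pos_iff.2 ⟨i⟩
  have h' : a * (M * (M * M)) ≤ b * (d * (M * M)) + a * (15 * (M * M * d)) :=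
    h.trans (Nat.add_le_add_left (Nat.mul_le_mul_left _ (by omega)) _)
  have hpos : 0 < M * M * d := by positivity
  have h'' : (a * m) * (M * M * d) ≤ (b + a * 15) * (M * M * d) := by
    rw [hm] at h' ⊢
    linarith
  have := Nat.le_of_mul_le_mul_right h'' hpos
  have : (a : ℝ) * m ≤ b + a * 15 := by exact_mod_cast this
  linarith

lemma le_card_agreeing_insert_mul {m : ℕ} (hm : Fintype.card α = m * d) (ht : t ∉ T) :
    (#(agreeing β d K i z T) : ℝ) * (1 - (2 / d + 13 / m)) ≤
      #(agreeing β d K i z (insert t T)) * m := by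
  classical
  have hiz : i ≠ z := fun h => hz (h ▸ hi)
  set M := Fintype.card α with hM
  have hup : ∑ F ∈ agreeing β d K i z (insert t T), #{x | IsSwitchable t K i z F x ∧ True} ≤
      #(agreeing β d K i z (insert t T)) * (M * (M * M)) := by
    rw [← smul_eq_mul]
    refine sum_le_card_nsmul _ _ _ fun F hF => ?_
    simpa [← hM] using card_switchable_le t K i z F fun _ => True
  have hlow : #(agreeing β d K i z T) * (d * (M * M)) ≤
      ∑ F ∈ agreeing β d K i z T, (#{x | IsSwitchable t K i z F x ∧ F x.1 t = F i t} +
        (2 * (M * M) + d * (13 * (M * d)))) := by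
    rw [← smul_eq_mul]
    refine card_nsmul_le_sum _ _ _ fun F hF => ?_
    obtain ⟨⟨hb, hK⟩, -⟩ := mem_agreeing.1 hF
    have := hb.le_card_switchable t hK hz hiz hd hd1 fun e => F e t = F i t
    rwa [hb, ← hM, add_assoc] at this
  rw [sum_add_distrib, ← sum_card_switchable ht, sum_const, smul_eq_mul] at hlow
  have h := hlow.trans (Nat.add_le_add_right hup _)
  generalize #(agreeing β d K i z (insert t T)) = a at *
  generalize #(agreeing β d K i z T) = b at *
  have hMpos : 0 < M := Fintype.card_pos_iff.2 ⟨i⟩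
  have hmpos : 0 < m := Nat.pos_of_ne_zero fun h0 => by simp [h0] at hm; omega
  have hdr : (0 : ℝ) < d := by exact_mod_cast hd1
  have hmr : (0 : ℝ) < m := by exact_mod_cast hmpos
  have hMr : (M : ℝ) = m * d := by exact_mod_cast hm
  have h' : (b : ℝ) * (d * (M * M)) ≤ a * (M * (M * M)) + b * (2 * (M * M) + d * (13 * (M * d))) := by
    exact_mod_cast h
  rw [hMr] at h'
  have hc : (0 : ℝ) < m ^ 2 * d ^ 3 := by positivity
  refine le_of_mul_le_mul_right ?_ hc
  have e1 : (b : ℝ) * (1 - (2 / d + 13 / m)) * (m ^ 2 * d ^ 3) =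
      b * (d * (m * d * (m * d))) - b * (2 * (m * d * (m * d)) + d * (13 * (m * d * d))) := by
    field_simp
  rw [e1]
  linarith

end Counting

section Extension

variable {α β : Type*} [Fintype α] [DecidableEq β] [DecidableEq α] [Fintype β]
variable {d m : ℕ} {K : Finset α} {i z : α}

lemma agreeing_empty : agreeing β d K i z ∅ = arrays β d K := by
  simp [agreeing]

lemma agreeing_univ_eq : agreeing β d K i z univ = {F ∈ arrays β d K | F z = F i} := by
  ext F
  simp [agreeing, funext_iff]

lemma card_arrays_insert (hz : z ∉ K) :
    #(arrays β d K) = #(arrays β d (insert z K)) + ∑ i ∈ K, #(agreeing β d K i z univ) := by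
  classical
  have h : arrays β d K = arrays β d (insert z K) ∪ K.biUnion fun i => agreeing β d K i z univ := by
    ext F
    have hz' : z ∉ (K : Set α) := by simpa using hz
    simp only [mem_union, mem_biUnion, agreeing_univ_eq, mem_filter, mem_arrays, coe_insert,
      Set.injOn_insert hz', Set.mem_image, mem_coe]
    grind
  rw [h, card_union_of_disjoint, card_biUnion]
  · intro i hi j hj hij
    refine disjoint_left.2 fun F hFi hFj => hij ?_
    simp only [agreeing_univ_eq, mem_filter, mem_arrays] at hFi hFj
    exact hFi.1.2 hi hj (hFi.2.symm.trans hFj.2)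
  · refine disjoint_left.2 fun F hF hF' => ?_
    obtain ⟨i, hi, hFi⟩ := mem_biUnion.1 hF'
    rw [agreeing_univ_eq, mem_filter] at hFi
    rw [mem_arrays] at hF
    exact hz ((hF.2 (by simp) (by simp [hi]) hFi.2) ▸ hi)

variable (hz : z ∉ K) (hd1 : 1 ≤ d) (hdm : d ≤ m) (hm : Fintype.card α = m * d)
include hz hd1 hdm hm

lemma card_agreeing_univ_le (hi : i ∈ K) (hm90 : 90 ≤ m) :
    (#(agreeing β d K i z univ) : ℝ) ≤ #(arrays β d K) * ((1 + 90 / m) / m ^ 3) := by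
  have hd : d * d ≤ Fintype.card α := by rw [hm]; gcongr
  have h0 := card_agreeing_insert_mul_le (β := β) hz hi hd hd1 hm (T := ∅) (t := 0) (by decide)
  have h1 := card_agreeing_insert_mul_le (β := β) hz hi hd hd1 hm (T := {0}) (t := 1) (by decide)
  have h2 := card_agreeing_insert_mul_le (β := β) hz hi hd hd1 hm (T := {1, 0}) (t := 2) (by decide)
  rw [agreeing_empty] at h0
  rw [show ({2, 1, 0} : Finset (Fin 3)) = univ by decide] at h2
  change (#(agreeing β d K i z {0}) : ℝ) * _ ≤ _ at h0
  have hmr : (90 : ℝ) ≤ m := by exact_mod_cast hm90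
  have hm15 : (0 : ℝ) < m - 15 := by linarith
  generalize (#(agreeing β d K i z univ) : ℝ) = b at *
  have hcube : b * (m - 15) ^ 3 ≤ #(arrays β d K) := by
    calc b * ((m : ℝ) - 15) ^ 3 = b * (m - 15) * (m - 15) ^ 2 := by ring
      _ ≤ (#(agreeing β d K i z {1, 0}) : ℝ) * (m - 15) ^ 2 := by gcongr
      _ = (#(agreeing β d K i z {1, 0}) : ℝ) * (m - 15) * (m - 15) := by ring
      _ ≤ (#(agreeing β d K i z {0}) : ℝ) * (m - 15) := by gcongr
      _ ≤ _ := h0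
  have hexp : (1 : ℝ) / (m - 15) ^ 3 ≤ (1 + 90 / m) / m ^ 3 := by
    rw [div_le_div_iff₀ (by positivity) (by positivity), one_mul]
    have : (1 + 90 / (m : ℝ)) * (m - 15) ^ 3 - m ^ 3 =
        (45 * m ^ 3 - 3375 * m ^ 2 + 57375 * m - 303750) / m := by
      field_simp
      ring
    have hpos : 0 ≤ (45 * (m : ℝ) ^ 3 - 3375 * m ^ 2 + 57375 * m - 303750) / m := by
      have : 45 * (m : ℝ) ^ 3 - 3375 * m ^ 2 + 57375 * m - 303750 =
        45 * m ^ 2 * (m - 75) + (57375 * m - 303750) := by ring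
      rw [this]
      have : (0 : ℝ) ≤ m - 75 := by linarith
      have : (0 : ℝ) ≤ 57375 * m - 303750 := by linarith
      positivity
    linarith
  calc b = b * (m - 15) ^ 3 * (1 / (m - 15) ^ 3) := by field_simp
    _ ≤ #(arrays β d K) * ((1 + 90 / m) / m ^ 3) := by gcongr

lemma le_card_agreeing_univ (hi : i ∈ K) :
    (#(arrays β d K) : ℝ) * ((1 - 3 * (2 / d + 13 / m)) / m ^ 3) ≤
      #(agreeing β d K i z univ) := by
  have hd : d * d ≤ Fintype.card α := by rw [hm]; gcongr
  have h0 := le_card_agreeing_insert_mul (β := β) hz hi hd hd1 hm (T := ∅) (t := 0) (by decide)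
  have h1 := le_card_agreeing_insert_mul (β := β) hz hi hd hd1 hm (T := {0}) (t := 1) (by decide)
  have h2 := le_card_agreeing_insert_mul (β := β) hz hi hd hd1 hm (T := {1, 0}) (t := 2) (by decide)
  rw [agreeing_empty] at h0
  rw [show ({2, 1, 0} : Finset (Fin 3)) = univ by decide] at h2
  change _ ≤ (#(agreeing β d K i z {0}) : ℝ) * _ at h0
  have hmr : (0 : ℝ) < m := by exact_mod_cast hd1.trans hdm
  set a : ℝ := 2 / d + 13 / m
  rw [mul_div_assoc', div_le_iff₀ (by positivity)]
  rcases le_total 0 (1 - a) with ha | ha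
  · calc (#(arrays β d K) : ℝ) * (1 - 3 * a) ≤ #(arrays β d K) * (1 - a) ^ 3 := by
          gcongr
          have := one_add_mul_le_pow (a := -a) (by linarith) 3
          push_cast at this
          rw [sub_eq_add_neg 1 a]
          linarith
      _ = #(arrays β d K) * (1 - a) * (1 - a) ^ 2 := by ring
      _ ≤ #(agreeing β d K i z {0}) * m * (1 - a) ^ 2 := by gcongr
      _ = #(agreeing β d K i z {0}) * (1 - a) * (m * (1 - a)) := by ring
      _ ≤ #(agreeing β d K i z {1, 0}) * m * (m * (1 - a)) := by gcongr
      _ = #(agreeing β d K i z {1, 0}) * (1 - a) * m ^ 2 := by ring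
      _ ≤ #(agreeing β d K i z univ) * m * m ^ 2 := by gcongr
      _ = _ := by ring
  · exact (mul_nonpos_of_nonneg_of_nonpos (by positivity) (by linarith)).trans (by positivity)

omit [DecidableEq α] hd1 hdm in
lemma card_lt_of_notMem : #K < m * d := by
  rw [← hm]
  exact card_lt_univ_of_notMem hz

lemma card_arrays_insert_le (hm2 : 2 ≤ m) :
    (#(arrays β d (insert z K)) : ℝ) ≤ #(arrays β d K) *
      ((1 - #K / m ^ 3) * Real.exp (6 * (2 / d + 13 / m) * (d / m ^ 2))) := by
  have hins : (#(arrays β d K) : ℝ) =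
      #(arrays β d (insert z K)) + ∑ i ∈ K, (#(agreeing β d K i z univ) : ℝ) := by
    exact_mod_cast card_arrays_insert hz
  have hK : (#K : ℝ) ≤ m * d := by exact_mod_cast (card_lt_of_notMem hz hm).le
  have hsum := card_nsmul_le_sum K (fun i => (#(agreeing β d K i z univ) : ℝ)) _
    fun i hi => le_card_agreeing_univ (β := β) hz hd1 hdm hm hi
  rw [nsmul_eq_mul] at hsum
  have hmr : (2 : ℝ) ≤ m := by exact_mod_cast hm2
  have hdr : (d : ℝ) ≤ m := by exact_mod_cast hdm
  set a : ℝ := 2 / d + 13 / m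
  have ha : 0 ≤ a := by positivity
  have hk : (#K : ℝ) / m ^ 3 ≤ d / m ^ 2 := by
    rw [div_le_div_iff₀ (by positivity) (by positivity)]
    nlinarith [pow_pos (by linarith : (0 : ℝ) < m) 2]
  have hhalf : (d : ℝ) / m ^ 2 ≤ 1 / 2 := by
    rw [div_le_div_iff₀ (by positivity) (by positivity)]
    nlinarith
  have hk0 : (0 : ℝ) ≤ (#K : ℝ) / m ^ 3 := by positivity
  set k : ℝ := (#K : ℝ) / m ^ 3 with hkdef
  have hstep : 1 - k * (1 - 3 * a) ≤ (1 - k) * Real.exp (6 * a * (d / m ^ 2)) :=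
    calc 1 - k * (1 - 3 * a) ≤ (1 - k) * (6 * a * k + 1) := by
          nlinarith [mul_nonneg ha hk0]
      _ ≤ (1 - k) * (6 * a * (d / m ^ 2) + 1) := by
          gcongr
          linarith
      _ ≤ _ := by
          gcongr
          · linarith
          · exact Real.add_one_le_exp _
  calc (#(arrays β d (insert z K)) : ℝ) ≤ #(arrays β d K) * (1 - k * (1 - 3 * a)) := by
        have : (#K : ℝ) * (#(arrays β d K) * ((1 - 3 * a) / m ^ 3)) =
          #(arrays β d K) * (k * (1 - 3 * a)) := by
            rw [hkdef]
            ring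
        linarith
    _ ≤ _ := by gcongr

lemma le_card_arrays_insert (hm90 : 90 ≤ m) :
    (#(arrays β d K) : ℝ) * ((1 - #K / m ^ 3) * (1 - 180 * d / m ^ 3)) ≤
      #(arrays β d (insert z K)) := by
  have hins : (#(arrays β d K) : ℝ) =
      #(arrays β d (insert z K)) + ∑ i ∈ K, (#(agreeing β d K i z univ) : ℝ) := by
    exact_mod_cast card_arrays_insert hz
  have hK : (#K : ℝ) ≤ m * d := by exact_mod_cast (card_lt_of_notMem hz hm).le
  have hsum := sum_le_card_nsmul K (fun i => (#(agreeing β d K i z univ) : ℝ)) _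
    fun i hi => card_agreeing_univ_le (β := β) hz hd1 hdm hm hi hm90
  rw [nsmul_eq_mul] at hsum
  have hmr : (90 : ℝ) ≤ m := by exact_mod_cast hm90
  have hdr : (d : ℝ) ≤ m := by exact_mod_cast hdm
  have hk : (#K : ℝ) / m ^ 3 ≤ d / m ^ 2 := by
    rw [div_le_div_iff₀ (by positivity) (by positivity)]
    nlinarith [pow_pos (by linarith : (0 : ℝ) < m) 2]
  have hhalf : (d : ℝ) / m ^ 2 ≤ 1 / 2 := by
    rw [div_le_div_iff₀ (by positivity) (by positivity)]
    nlinarith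
  have hk0 : (0 : ℝ) ≤ (#K : ℝ) / m ^ 3 := by positivity
  set k : ℝ := (#K : ℝ) / m ^ 3 with hkdef
  have hstep : (1 - k) * (1 - 180 * d / m ^ 3) ≤ 1 - k * (1 + 90 / m) := by
    have h1 : 180 * (d : ℝ) / m ^ 3 = 180 / m * (d / m ^ 2) := by field_simp
    have h2 : (0 : ℝ) ≤ 90 / m := by positivity
    have h3 : 180 / (m : ℝ) = 2 * (90 / m) := by ring
    rw [h1, h3]
    generalize (90 : ℝ) / m = c at *
    nlinarith [mul_nonneg h2 hk0, mul_nonneg h2 (sub_nonneg.2 hk),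
      mul_nonneg (mul_nonneg h2 (sub_nonneg.2 hk)) (by linarith : 0 ≤ 1 - k)]
  calc _ ≤ #(arrays β d K) * (1 - k * (1 + 90 / m)) := by gcongr
    _ ≤ _ := by
        have : (#K : ℝ) * (#(arrays β d K) * ((1 + 90 / m) / m ^ 3)) =
          #(arrays β d K) * (k * (1 + 90 / m)) := by
            rw [hkdef]
            ring
        linarith

end Extension

section Distinct

variable {α β : Type*} [Fintype α] [DecidableEq β] [DecidableEq α] [Fintype β]
variable {d m : ℕ} (hdm : d ≤ m) (hm : Fintype.card α = m * d)
include hdm hm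

lemma card_arrays_univ_le (hm2 : 2 ≤ m) :
    (#(arrays β d (univ : Finset α)) : ℝ) ≤ #(arrays β d (∅ : Finset α)) *
      ((∏ n ∈ range (m * d), (1 - n / m ^ 3 : ℝ)) *
        Real.exp (12 * (d / m) + 78 * (d / m) ^ 2)) := by
  have hmr : (0 : ℝ) < m := by exact_mod_cast (by omega : 0 < m)
  have key (K : Finset α) : (#(arrays β d K) : ℝ) ≤ #(arrays β d (∅ : Finset α)) *
      ((∏ n ∈ range #K, (1 - n / m ^ 3 : ℝ)) *
        Real.exp (6 * (2 / d + 13 / m) * (d / m ^ 2)) ^ #K) := by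
    induction K using Finset.induction_on with
    | empty => simp
    | insert z K hz ih =>
      have hlt := card_lt_of_notMem hz hm
      have hd1 : 1 ≤ d := Nat.pos_of_ne_zero fun h => by simp [h] at hlt
      have hK : (#K : ℝ) / m ^ 3 ≤ 1 := by
        rw [div_le_one (by positivity)]
        exact_mod_cast hlt.le.trans (by nlinarith [Nat.pow_le_pow_left hm2 2])
      rw [card_insert_of_notMem hz, prod_range_succ, pow_succ _ #K]
      refine (card_arrays_insert_le hz hd1 hdm hm hm2).trans ?_
      calc _ ≤ _ := mul_le_mul_of_nonneg_right ih
              (mul_nonneg (by linarith) (Real.exp_pos _).le)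
        _ = _ := by rw [mul_assoc, mul_mul_mul_comm]
  refine (key univ).trans_eq ?_
  rw [card_univ, hm, ← Real.exp_nat_mul]
  congr 3
  rcases Nat.eq_zero_or_pos d with rfl | hd
  · simp
  · push_cast
    field_simp
    ring

lemma le_card_arrays_univ (hm90 : 90 ≤ m) :
    (#(arrays β d (∅ : Finset α)) : ℝ) *
      ((∏ n ∈ range (m * d), (1 - n / m ^ 3 : ℝ)) * (1 - 180 * (d / m) ^ 2)) ≤
      #(arrays β d (univ : Finset α)) := by
  have hmr : (90 : ℝ) ≤ m := by exact_mod_cast hm90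
  have hdr : (d : ℝ) ≤ m := by exact_mod_cast hdm
  have hsmall : (180 * d / m ^ 3 : ℝ) ≤ 1 := by
    rw [div_le_one (by positivity)]
    nlinarith [mul_le_mul hmr hmr (by norm_num) (by linarith)]
  have hfac {n : ℕ} (hn : n < m * d) : (n : ℝ) / m ^ 3 ≤ 1 := by
    rw [div_le_one (by positivity)]
    exact_mod_cast hn.le.trans (by nlinarith [Nat.pow_le_pow_left hm90 2])
  have key (K : Finset α) : (#(arrays β d (∅ : Finset α)) : ℝ) *
      ((∏ n ∈ range #K, (1 - n / m ^ 3 : ℝ)) * (1 - 180 * d / m ^ 3) ^ #K) ≤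
        #(arrays β d K) := by
    induction K using Finset.induction_on with
    | empty => simp
    | insert z K hz ih =>
      have hlt := card_lt_of_notMem hz hm
      have hd1 : 1 ≤ d := Nat.pos_of_ne_zero fun h => by simp [h] at hlt
      rw [card_insert_of_notMem hz, prod_range_succ, pow_succ _ #K]
      refine le_trans ?_ (le_card_arrays_insert hz hd1 hdm hm hm90)
      calc _ = _ := by rw [mul_mul_mul_comm, ← mul_assoc]
        _ ≤ _ := mul_le_mul_of_nonneg_right ih
              (mul_nonneg (by linarith [hfac hlt]) (by linarith))
  refine le_trans ?_ (key univ)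
  rw [card_univ, hm]
  gcongr
  · exact prod_nonneg fun n hn => sub_nonneg.2 (hfac (mem_range.1 hn))
  · have := one_add_mul_le_pow (a := -(180 * d / m ^ 3 : ℝ)) (by linarith) (m * d)
    rw [← sub_eq_add_neg] at this
    refine le_trans (le_of_eq ?_) this
    push_cast
    field_simp
    ring

end Distinct

section Enumeration

open scoped Nat

variable {α β : Type*} [Fintype α] [DecidableEq β] {d : ℕ}

lemma isBalanced_iff_of_injective {F : α → Fin 3 → β} (hF : F.Injective) :
    IsBalanced d F ↔ ∀ t v, #{e ∈ univ.image F | e t = v} = d := by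
  refine forall₂_congr fun t v => ?_
  rw [filter_image, card_image_of_injective _ hF]

lemma card_arrays_univ_eq (m d : ℕ) :
    #(arrays (Fin m) d (univ : Finset (Fin (m * d)))) = (m * d)! * Hcount 3 m d := by
  classical
  let S := {E : Finset (Fin 3 → Fin m) // ∀ t : Fin 3, ∀ v : Fin m, #{e ∈ E | e t = v} = d}
  have himage (E : S) (e : Fin (m * d) ≃ E.1) : univ.image (fun i => (e i).1) = E.1 := by
    ext x
    simp only [mem_image, mem_univ, true_and]
    exact ⟨fun ⟨i, hi⟩ => hi ▸ (e i).2, fun hx => ⟨e.symm ⟨x, hx⟩, by simp⟩⟩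
  have hinj (E : S) (e : Fin (m * d) ≃ E.1) : (fun i => (e i).1).Injective :=
    Subtype.val_injective.comp e.injective
  let Φ : (Σ E : S, Fin (m * d) ≃ E.1) → arrays (Fin m) d (univ : Finset (Fin (m * d))) :=
    fun x => ⟨fun i => (x.2 i).1, mem_arrays.2
      ⟨(isBalanced_iff_of_injective (hinj x.1 x.2)).2 (by rw [himage]; exact x.1.2),
        (hinj x.1 x.2).injOn⟩⟩
  have hΦ : Φ.Bijective := by
    constructor
    · rintro ⟨E, e⟩ ⟨E', e'⟩ h
      have h1 : (fun i => (e i).1) = fun i => (e' i).1 := congrArg Subtype.val h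
      obtain rfl : E = E' := Subtype.ext <| by rw [← himage E e, ← himage E' e', h1]
      obtain rfl : e = e' := Equiv.ext fun i => Subtype.ext (congrFun h1 i)
      rfl
    · rintro ⟨F, hF⟩
      obtain ⟨hF, hFi⟩ := mem_arrays.1 hF
      rw [coe_univ, Set.injOn_univ] at hFi
      refine ⟨⟨⟨univ.image F, (isBalanced_iff_of_injective hFi).1 hF⟩,
        Equiv.ofBijective (fun i => ⟨F i, mem_image_of_mem F (mem_univ i)⟩) ⟨fun i j h => ?_, ?_⟩⟩,
        rfl⟩
      · exact hFi (congrArg Subtype.val h)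
      · rintro ⟨x, hx⟩
        obtain ⟨i, -, rfl⟩ := mem_image.1 hx
        exact ⟨i, rfl⟩
  have hcard (E : S) : #E.1 = m * d := by
    rw [card_eq_sum_card_fiberwise (f := fun e => e 0) (t := univ) (by simp)]
    simp [E.2]
  rw [← Fintype.card_coe, ← Fintype.card_of_bijective hΦ, Fintype.card_sigma]
  have h (E : S) : Fintype.card (Fin (m * d) ≃ E.1) = (m * d)! := by
    rw [Fintype.card_equiv (Fintype.equivOfCardEq (by simp [hcard])), Fintype.card_fin]
  simp only [h, sum_const, card_univ, smul_eq_mul]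
  rw [mul_comm, Hcount, Nat.card_eq_fintype_card]

lemma card_balanced_columns_mul (m d : ℕ) :
    Fintype.card {f : Fin (m * d) → Fin m // ∀ v, #{i | f i = v} = d} * d ! ^ m = (m * d)! := by
  classical
  let B := {f : Fin (m * d) → Fin m // ∀ v, #{i | f i = v} = d}
  let ψ (e : Fin (m * d) ≃ Fin m × Fin d) (v : Fin m) : {i // (e i).1 = v} ≃ Fin d :=
    { toFun := fun i => (e i).2
      invFun := fun j => ⟨e.symm (v, j), by simp⟩
      left_inv := by rintro ⟨i, rfl⟩; simp
      right_inv := fun j => by simp }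
  let Φ : (Σ f : B, ∀ v, {i // f.1 i = v} ≃ Fin d) → (Fin (m * d) ≃ Fin m × Fin d) :=
    fun x => (Equiv.sigmaFiberEquiv x.1.1).symm.trans
      ((Equiv.sigmaCongrRight x.2).trans (Equiv.sigmaEquivProd _ _))
  have hΦ : Φ.Bijective := by
    constructor
    · rintro ⟨f, g⟩ ⟨f', g'⟩ h
      have h1 (i) : (f.1 i, g (f.1 i) ⟨i, rfl⟩) = (f'.1 i, g' (f'.1 i) ⟨i, rfl⟩) :=
        congrArg (fun e : Fin (m * d) ≃ Fin m × Fin d => e i) h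
      obtain rfl : f = f' := Subtype.ext <| funext fun i => congrArg Prod.fst (h1 i)
      obtain rfl : g = g' := by
        funext v
        ext ⟨i, rfl⟩
        exact congrArg (fun x => (x.2 : ℕ)) (h1 i)
      rfl
    · intro e
      refine ⟨⟨⟨fun i => (e i).1, fun v => ?_⟩, ψ e⟩, Equiv.ext fun i => rfl⟩
      rw [← Fintype.card_subtype, Fintype.card_congr (ψ e v), Fintype.card_fin]
  have h1 := Fintype.card_of_bijective hΦ
  have h2 (f : B) (v : Fin m) : Fintype.card ({i // f.1 i = v} ≃ Fin d) = d ! := by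
    have hc : Fintype.card {i // f.1 i = v} = d := by rw [Fintype.card_subtype, f.2 v]
    rw [Fintype.card_equiv (Fintype.equivOfCardEq (by simp [hc])), hc]
  rw [Fintype.card_sigma, Fintype.card_equiv finProdFinEquiv.symm, Fintype.card_fin] at h1
  simpa [Fintype.card_pi, h2] using h1

lemma card_arrays_empty_mul (m d : ℕ) :
    #(arrays (Fin m) d (∅ : Finset (Fin (m * d)))) * d ! ^ (3 * m) = (m * d)! ^ 3 := by
  classical
  let e : arrays (Fin m) d (∅ : Finset (Fin (m * d))) ≃
      (Fin 3 → {f : Fin (m * d) → Fin m // ∀ v, #{i | f i = v} = d}) :=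
    { toFun := fun F t => ⟨fun i => F.1 i t, (mem_arrays.1 F.2).1 t⟩
      invFun := fun f => ⟨fun i t => (f t).1 i, mem_arrays.2 ⟨fun t => (f t).2, by simp⟩⟩
      left_inv := fun F => rfl
      right_inv := fun f => rfl }
  rw [← Fintype.card_coe, Fintype.card_congr e, Fintype.card_fun, Fintype.card_fin, mul_comm 3 m,
    pow_mul, ← mul_pow, card_balanced_columns_mul]

lemma card_arrays_empty_pos (m d : ℕ) : 0 < #(arrays (Fin m) d (∅ : Finset (Fin (m * d)))) := by
  refine Nat.pos_of_mul_pos_right (b := d ! ^ (3 * m)) ?_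
  rw [card_arrays_empty_mul]
  positivity

end Enumeration

section Ratio

open scoped Nat

lemma descFactorial_eq_pow_mul_prod {N : ℕ} (hN : 0 < N) (k : ℕ) (hk : k ≤ N) :
    (N.descFactorial k : ℝ) = N ^ k * ∏ n ∈ range k, (1 - n / N : ℝ) := by
  have hN' : (N : ℝ) ≠ 0 := by positivity
  rw [Nat.descFactorial_eq_prod_range, Nat.cast_prod, ← card_range k, ← prod_const, card_range,
    ← prod_mul_distrib]
  refine prod_congr rfl fun n hn => ?_
  rw [Nat.cast_sub ((mem_range.1 hn).le.trans hk)]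
  field_simp

lemma choose_eq_pow_mul_prod_div {N : ℕ} (hN : 0 < N) (k : ℕ) (hk : k ≤ N) :
    (N.choose k : ℝ) = N ^ k * (∏ n ∈ range k, (1 - n / N : ℝ)) / k ! := by
  rw [← descFactorial_eq_pow_mul_prod hN k hk, Nat.descFactorial_eq_factorial_mul_choose]
  push_cast
  field_simp

lemma prod_one_sub_block {m k : ℕ} (hm : 0 < m) (hk : k < m) :
    (∏ n ∈ range (m * k), (1 - n / m ^ 3 : ℝ) ≤ (∏ j ∈ range k, (1 - j / m ^ 2 : ℝ)) ^ m) ∧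
      (∏ j ∈ range (k + 1), (1 - j / m ^ 2 : ℝ)) ^ m ≤ ∏ n ∈ range (m * k), (1 - n / m ^ 3 : ℝ) := by
  have hm' : (0 : ℝ) < m := by exact_mod_cast hm
  have hlow (x : ℝ) (hx : x ≤ m) : 0 ≤ 1 - x / m ^ 2 := by
    rw [sub_nonneg, div_le_one (by positivity)]
    nlinarith [show (1 : ℝ) ≤ m by exact_mod_cast hm]
  induction k with
  | zero => simp
  | succ k ih =>
    obtain ⟨h1, h2⟩ := ih (by omega)
    have hkm : (k : ℝ) + 1 ≤ m := by exact_mod_cast hk.le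
    have hf (i) (hi : i ∈ range m) : (1 - ((k + 1 : ℕ) : ℝ) / m ^ 2) ≤
        1 - ((m * k + i : ℕ) : ℝ) / m ^ 3 ∧ 1 - ((m * k + i : ℕ) : ℝ) / m ^ 3 ≤ 1 - k / m ^ 2 := by
      have hi' : (i : ℝ) ≤ m := by exact_mod_cast (mem_range.1 hi).le
      have e (x : ℝ) : x / m ^ 2 = (m * x) / m ^ 3 := by field_simp
      rw [e, e]
      push_cast
      constructor <;> gcongr
      · linarith
      · linarith [Nat.cast_nonneg (α := ℝ) i]
    have hk1 := hlow ((k + 1 : ℕ) : ℝ) (by push_cast; exact hkm)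
    have hk2 := hlow k (by linarith)
    have hQ (l : ℕ) (hl : l ≤ m) : 0 ≤ ∏ j ∈ range l, (1 - j / m ^ 2 : ℝ) :=
      prod_nonneg fun j hj => hlow j (by exact_mod_cast (mem_range.1 hj).le.trans hl)
    have hu : ∏ i ∈ range m, (1 - ((m * k + i : ℕ) : ℝ) / m ^ 3) ≤ (1 - k / m ^ 2 : ℝ) ^ m := by
      calc _ ≤ ∏ _i ∈ range m, (1 - k / m ^ 2 : ℝ) :=
            prod_le_prod (fun i hi => hk1.trans (hf i hi).1) fun i hi => (hf i hi).2
        _ = _ := by simp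
    have hl : (1 - ((k + 1 : ℕ) : ℝ) / m ^ 2) ^ m ≤
        ∏ i ∈ range m, (1 - ((m * k + i : ℕ) : ℝ) / m ^ 3) := by
      calc _ = ∏ _i ∈ range m, (1 - ((k + 1 : ℕ) : ℝ) / m ^ 2) := by simp
        _ ≤ _ := prod_le_prod (fun i hi => hk1) fun i hi => (hf i hi).1
    have hpos : 0 ≤ ∏ i ∈ range m, (1 - ((m * k + i : ℕ) : ℝ) / m ^ 3) :=
      prod_nonneg fun i hi => hk1.trans (hf i hi).1
    rw [mul_add_one, prod_range_add]
    constructor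
    · rw [prod_range_succ, mul_pow]
      have := hQ k (by omega)
      gcongr
    · rw [prod_range_succ, mul_pow]
      have := hQ (k + 1) hk.le
      have := (pow_nonneg this m).trans h2
      gcongr

lemma one_sub_mul_pow_le_prod {m d : ℕ} (hm : 0 < m) (hd : d < m) :
    (1 - d / m : ℝ) * (∏ j ∈ range d, (1 - j / m ^ 2 : ℝ)) ^ m ≤
      ∏ n ∈ range (m * d), (1 - n / m ^ 3 : ℝ) := by
  refine le_trans ?_ (prod_one_sub_block hm hd).2
  have hm' : (1 : ℝ) ≤ m := by exact_mod_cast hm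
  have hdm : (d : ℝ) ≤ m := by exact_mod_cast hd.le
  have hQ : 0 ≤ ∏ j ∈ range d, (1 - j / m ^ 2 : ℝ) := prod_nonneg fun j hj => by
    have hj : (j : ℝ) ≤ d := by exact_mod_cast (mem_range.1 hj).le
    rw [sub_nonneg, div_le_one (by positivity)]
    nlinarith
  have hb := one_add_mul_le_pow (a := -(d / m ^ 2 : ℝ)) (by
    have : (d / m ^ 2 : ℝ) ≤ 1 := by rw [div_le_one (by positivity)]; nlinarith
    linarith) m
  rw [prod_range_succ, mul_pow, mul_comm]
  gcongr
  refine le_trans (le_of_eq ?_) (hb.trans_eq (by ring))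
  field_simp
  ring

lemma prod_one_sub_div_cube_pos {m d : ℕ} (hm : 0 < m) (hd : d < m) :
    0 < ∏ n ∈ range (m * d), (1 - n / m ^ 3 : ℝ) := by
  refine prod_pos fun n hn => ?_
  rw [sub_pos, div_lt_one (by positivity)]
  have h : n < m ^ 3 := calc
    n < m * d := mem_range.1 hn
    _ ≤ m * m := by gcongr
    _ ≤ m * m * m := Nat.le_mul_of_pos_right _ hm
    _ = m ^ 3 := by ring
  exact_mod_cast h

lemma prod_one_sub_div_sq_pos {m d : ℕ} (hm : 0 < m) (hd : d < m) :
    0 < ∏ j ∈ range d, (1 - j / m ^ 2 : ℝ) := by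
  refine prod_pos fun j hj => ?_
  rw [sub_pos, div_lt_one (by positivity)]
  have h : j < m ^ 2 := (mem_range.1 hj).trans (hd.trans_le (Nat.le_self_pow two_ne_zero m))
  exact_mod_cast h

lemma Hhat_three_eq {m d : ℕ} (hm : 0 < m) (hd : d < m) :
    Hhat 3 m d = ((∏ j ∈ range d, (1 - j / m ^ 2 : ℝ)) ^ m) ^ 3 * (m * d)! ^ 2 /
      (d ! ^ (3 * m) * (∏ n ∈ range (m * d), (1 - n / m ^ 3 : ℝ)) ^ 2) := by
  have h2 : d ≤ m ^ 2 := hd.le.trans (Nat.le_self_pow two_ne_zero m)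
  have h3 : m * d ≤ m ^ 3 := by
    rw [pow_succ' m 2]
    gcongr
  have hP := prod_one_sub_div_cube_pos hm hd
  have hm' : (m : ℝ) ≠ 0 := by positivity
  rw [Hhat, choose_eq_pow_mul_prod_div (by positivity) _ h2,
    choose_eq_pow_mul_prod_div (by positivity) _ h3]
  push_cast
  generalize ∏ n ∈ range (m * d), (1 - n / m ^ 3 : ℝ) = P at *
  generalize ∏ j ∈ range d, (1 - j / m ^ 2 : ℝ) = Q
  have e : ((m : ℝ) ^ 2) ^ d = m ^ (2 * d) := (pow_mul _ _ _).symm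
  have e1 : (((m : ℝ) ^ 2) ^ d) ^ (3 * m) = (((m : ℝ) ^ 3) ^ (m * d)) ^ 2 := by
    simp only [← pow_mul]
    congr 1
    ring
  rw [div_pow, div_pow, mul_pow, mul_pow, e1, mul_comm 3 m, pow_mul Q]
  field_simp

lemma Hcount_div_Hhat_eq {m d : ℕ} (hm : 0 < m) (hd : d < m) :
    ((Hcount 3 m d : ℝ) / Hhat 3 m d) *
        (#(arrays (Fin m) d (∅ : Finset (Fin (m * d)))) *
          ∏ n ∈ range (m * d), (1 - n / m ^ 3 : ℝ)) =
      #(arrays (Fin m) d (univ : Finset (Fin (m * d)))) *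
        ((∏ n ∈ range (m * d), (1 - n / m ^ 3 : ℝ)) /
          (∏ j ∈ range d, (1 - j / m ^ 2 : ℝ)) ^ m) ^ 3 := by
  have hA : (#(arrays (Fin m) d (∅ : Finset (Fin (m * d)))) : ℝ) * d ! ^ (3 * m) = (m * d)! ^ 3 := by
    exact_mod_cast card_arrays_empty_mul m d
  have hA : (#(arrays (Fin m) d (∅ : Finset (Fin (m * d)))) : ℝ) = (m * d)! ^ 3 / d ! ^ (3 * m) := by
    rw [← hA]
    field_simp
  rw [Hhat_three_eq hm hd, card_arrays_univ_eq, hA, Nat.cast_mul]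
  have hP := prod_one_sub_div_cube_pos hm hd
  have hQ := prod_one_sub_div_sq_pos hm hd
  generalize ∏ n ∈ range (m * d), (1 - n / m ^ 3 : ℝ) = P at *
  generalize ∏ j ∈ range d, (1 - j / m ^ 2 : ℝ) = Q at *
  have hQm : Q ^ m ≠ 0 := by positivity
  generalize Q ^ m = R at *
  field_simp


lemma Hcount_div_Hhat_le {m d : ℕ} (hm90 : 90 ≤ m) (hd : d < m) :
    (Hcount 3 m d : ℝ) / Hhat 3 m d ≤ Real.exp (12 * (d / m) + 78 * (d / m) ^ 2) := by
  have hm : 0 < m := by omega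
  have hP := prod_one_sub_div_cube_pos hm hd
  have hQ := prod_one_sub_div_sq_pos hm hd
  have hA : (0 : ℝ) < #(arrays (Fin m) d (∅ : Finset (Fin (m * d)))) := by
    exact_mod_cast card_arrays_empty_pos m d
  have hU := card_arrays_univ_le (α := Fin (m * d)) (β := Fin m) hd.le (by simp) (by omega)
  have hρ := (prod_one_sub_block hm hd).1
  refine le_of_mul_le_mul_right ?_ (mul_pos hA hP)
  rw [Hcount_div_Hhat_eq hm hd]
  calc _ ≤ _ * (1 : ℝ) ^ 3 := by
        gcongr
        exact div_le_one_of_le₀ hρ (by positivity)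
    _ ≤ _ := by linarith

lemma le_Hcount_div_Hhat {m d : ℕ} (hm90 : 90 ≤ m) (hd : d < m) :
    (1 - d / m : ℝ) ^ 3 * (1 - 180 * (d / m) ^ 2) ≤ (Hcount 3 m d : ℝ) / Hhat 3 m d := by
  have hm : 0 < m := by omega
  have hP := prod_one_sub_div_cube_pos hm hd
  have hQ := prod_one_sub_div_sq_pos hm hd
  have hA : (0 : ℝ) < #(arrays (Fin m) d (∅ : Finset (Fin (m * d)))) := by
    exact_mod_cast card_arrays_empty_pos m d
  have hU := le_card_arrays_univ (α := Fin (m * d)) (β := Fin m) hd.le (by simp) hm90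
  have hρ := one_sub_mul_pow_le_prod hm hd
  have hx : (0 : ℝ) ≤ 1 - d / m := by
    rw [sub_nonneg, div_le_one (by positivity)]
    exact_mod_cast hd.le
  refine le_of_mul_le_mul_right ?_ (mul_pos hA hP)
  rw [Hcount_div_Hhat_eq hm hd]
  calc _ = (#(arrays (Fin m) d (∅ : Finset (Fin (m * d)))) *
          ((∏ n ∈ range (m * d), (1 - n / m ^ 3 : ℝ)) * (1 - 180 * (d / m) ^ 2))) *
          (1 - d / m : ℝ) ^ 3 := by ring
    _ ≤ #(arrays (Fin m) d (univ : Finset (Fin (m * d)))) * (1 - d / m : ℝ) ^ 3 := by gcongr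
    _ ≤ _ := by
      gcongr
      rwa [le_div_iff₀ (by positivity)]

end Ratio

end

/-- for `r = 3`, if `m → ∞` and `d = d(m) = o(m)` is a sequence of nonnegative
integers, then `H_3(d,m) = (1+o(1))·Ĥ_3(d,m)`. -/
theorem regular_tripartite_hypergraph_count_sparse
    (d : ℕ → ℕ)
    (hdo : (fun m => (d m : ℝ)) =o[atTop] (fun m => (m : ℝ))) :
    Tendsto (fun m => (Hcount 3 m (d m) : ℝ) / Hhat 3 m (d m)) atTop (nhds 1) := by
  have hx : Tendsto (fun m => (d m / m : ℝ)) atTop (nhds 0) := hdo.tendsto_div_nhds_zero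
  have hlt : ∀ᶠ m in atTop, 90 ≤ m ∧ d m < m := by
    filter_upwards [hx.eventually_lt_const zero_lt_one, eventually_ge_atTop 90] with m h1 h2
    refine ⟨h2, ?_⟩
    rw [div_lt_one (by positivity)] at h1
    exact_mod_cast h1
  have hlow : Tendsto (fun m => (1 - d m / m : ℝ) ^ 3 * (1 - 180 * (d m / m) ^ 2)) atTop (nhds 1) := by
    have h := (Continuous.tendsto (f := fun x : ℝ => (1 - x) ^ 3 * (1 - 180 * x ^ 2))
      (by fun_prop) 0).comp hx
    simpa [Function.comp_def] using h
  have hup : Tendsto (fun m => Real.exp (12 * (d m / m) + 78 * (d m / m) ^ 2)) atTop (nhds 1) := by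
    have h := (Continuous.tendsto (f := fun x : ℝ => Real.exp (12 * x + 78 * x ^ 2))
      (by fun_prop) 0).comp hx
    simpa [Function.comp_def] using h
  refine tendsto_of_tendsto_of_tendsto_of_le_of_le' hlow hup ?_ ?_
  · filter_upwards [hlt] with m hm using le_Hcount_div_Hhat hm.1 hm.2
  · filter_upwards [hlt] with m hm using Hcount_div_Hhat_le hm.1 hm.2
end

section
/- Let n = rm → ∞ with integers r = r(n) ≥ 3, m = m(n) ≥ 1, and let d = d(n) ≥ 0 be integers with r·d² = o(m^{r−2}). Then H_r(d,m) = (1+o(1))·Ĥ_r(d,m). -/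
open Filter Asymptotics

open Finset in
/-- The functions from `α` to `Fin m` all of whose fibres have exactly `d` elements. -/
def balancedFunctions (α : Type*) [Fintype α] [DecidableEq α] (m d : ℕ) :
    Finset (α → Fin m) :=
  univ.filter fun f => ∀ v, (univ.filter fun a => f a = v).card = d

section Counting

open Finset
open scoped Nat

variable {α : Type*} [Fintype α] [DecidableEq α] {m d r : ℕ}

lemma mem_balancedFunctions {f : α → Fin m} :
    f ∈ balancedFunctions α m d ↔ ∀ v, (univ.filter fun a => f a = v).card = d := by
  simp [balancedFunctions]

lemma comp_perm_mem_balancedFunctions (σ : Equiv.Perm α) {f : α → Fin m}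
    (hf : f ∈ balancedFunctions α m d) : f ∘ σ ∈ balancedFunctions α m d := by
  rw [mem_balancedFunctions] at hf ⊢
  intro v
  rw [← hf v]
  exact card_equiv σ (by simp)

lemma fst_mem_balancedFunctions :
    (Prod.fst : Fin m × Fin d → Fin m) ∈ balancedFunctions (Fin m × Fin d) m d := by
  rw [mem_balancedFunctions]
  intro v
  have : (univ.filter fun a : Fin m × Fin d => a.1 = v) = {v} ×ˢ univ := by
    ext ⟨a, b⟩; simp [eq_comm]
  rw [this, card_product]
  simp

lemma exists_perm_of_mem_balancedFunctions {f : Fin m × Fin d → Fin m}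
    (hf : f ∈ balancedFunctions (Fin m × Fin d) m d) :
    ∃ σ : Equiv.Perm (Fin m × Fin d), Prod.fst ∘ σ = f := by
  rw [mem_balancedFunctions] at hf
  have e (v : Fin m) : Nonempty ({a // f a = v} ≃ Fin d) := by
    refine ⟨Fintype.equivFinOfCardEq ?_⟩
    rw [Fintype.card_subtype, hf v]
  replace e := fun v => (e v).some
  refine ⟨(Equiv.sigmaFiberEquiv f).symm.trans
    ((Equiv.sigmaCongrRight e).trans (Equiv.sigmaEquivProd _ _)), ?_⟩
  ext a
  rfl

lemma card_balancedFunctions_mul :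
    (balancedFunctions (Fin m × Fin d) m d).card * d ! ^ m = (m * d)! := by
  have hfib : ∀ f ∈ balancedFunctions (Fin m × Fin d) m d,
      (univ.filter fun σ : Equiv.Perm (Fin m × Fin d) => Prod.fst ∘ σ = f).card = d ! ^ m := by
    intro f hf
    obtain ⟨σ₀, rfl⟩ := exists_perm_of_mem_balancedFunctions hf
    have h1 := DomMulAct.stabilizer_card (Prod.fst : Fin m × Fin d → Fin m)
    have h2 (v : Fin m) : Fintype.card {a : Fin m × Fin d // a.1 = v} = d := by
      rw [Fintype.card_subtype]
      exact mem_balancedFunctions.1 fst_mem_balancedFunctions v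
    simp only [h2, prod_const, card_univ, Fintype.card_fin] at h1
    rw [← h1, Fintype.card_subtype]
    refine card_equiv (Equiv.mulRight σ₀⁻¹) fun σ => ?_
    simp only [mem_filter, mem_univ, true_and, Equiv.coe_mulRight, Equiv.Perm.coe_mul,
      ← Function.comp_assoc]
    rw [Equiv.Perm.inv_def, Equiv.comp_symm_eq]
  have h := card_eq_sum_card_fiberwise
    (s := (univ : Finset (Equiv.Perm (Fin m × Fin d))))
    (f := fun σ : Equiv.Perm (Fin m × Fin d) => (Prod.fst ∘ σ : Fin m × Fin d → Fin m))
    (t := balancedFunctions (Fin m × Fin d) m d)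
    fun σ _ => comp_perm_mem_balancedFunctions σ fst_mem_balancedFunctions
  rw [sum_congr rfl hfib, card_univ, Fintype.card_perm] at h
  simpa using h.symm

lemma card_filter_apply_eq_apply_swap {a b c : α} (hab : a ≠ b) (hac : a ≠ c) :
    ((balancedFunctions α m d).filter fun f => f a = f c).card
      = ((balancedFunctions α m d).filter fun f => f a = f b).card := by
  refine card_equiv ((Equiv.swap b c).arrowCongr (Equiv.refl _)) fun f => ?_
  have hmem : f ∈ balancedFunctions α m d ↔ f ∘ Equiv.swap b c ∈ balancedFunctions α m d := by
    refine ⟨comp_perm_mem_balancedFunctions _, fun h => ?_⟩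
    have := comp_perm_mem_balancedFunctions (Equiv.swap b c) h
    rwa [Function.comp_assoc, ← Equiv.Perm.coe_mul, Equiv.swap_mul_self] at this
  have hcomp : (Equiv.swap b c).arrowCongr (Equiv.refl (Fin m)) f = f ∘ Equiv.swap b c := by
    ext; simp [Equiv.arrowCongr]
  rw [hcomp, mem_filter, mem_filter, ← hmem]
  simp [Equiv.swap_apply_of_ne_of_ne hab hac]

lemma sum_card_filter_apply_eq_apply (a : α) :
    ∑ c ∈ univ.erase a, ((balancedFunctions α m d).filter fun f => f a = f c).card
      = (balancedFunctions α m d).card * (d - 1) := by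
  have hfib : ∀ f ∈ balancedFunctions α m d,
      ((univ.erase a).filter fun c => f a = f c).card = d - 1 := by
    intro f hf
    rw [← mem_balancedFunctions.1 hf (f a), filter_erase, card_erase_of_mem (by simp)]
    simp only [eq_comm]
  rw [← smul_eq_mul, ← sum_const, ← sum_congr rfl hfib]
  exact sum_card_bipartiteAbove_eq_sum_card_bipartiteBelow
    (fun (c : α) (f : α → Fin m) => f a = f c)

lemma card_collision_mul_le (hα : Fintype.card α = m * d) {a b : α} (hab : a ≠ b) :
    m * ((balancedFunctions α m d).filter fun f => f a = f b).card
      ≤ (balancedFunctions α m d).card := by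
  have hcount := sum_card_filter_apply_eq_apply (m := m) (d := d) a
  rw [sum_congr rfl fun c hc =>
    card_filter_apply_eq_apply_swap hab (ne_of_mem_erase hc).symm, sum_const,
    card_erase_of_mem (mem_univ _), card_univ, hα, smul_eq_mul] at hcount
  have h2 : 2 ≤ m * d := hα ▸ Fintype.one_lt_card_iff.2 ⟨a, b, hab⟩
  have hm : 1 ≤ m := Nat.pos_of_ne_zero (by rintro rfl; simp at h2)
  generalize ((balancedFunctions α m d).filter fun f => f a = f b).card = q at hcount ⊢
  refine le_of_mul_le_mul_left ?_ (show 0 < m * d - 1 by omega)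
  calc (m * d - 1) * (m * q) = m * ((m * d - 1) * q) := by ring
    _ = (m * (d - 1)) * (balancedFunctions α m d).card := by rw [hcount]; ring
    _ ≤ (m * d - 1) * (balancedFunctions α m d).card := by
      gcongr
      rw [Nat.mul_sub]
      omega

/-- Families of `r` balanced functions, read as sequences of edges indexed by `α`, in which no
edge is repeated. -/
def simpleFamilies (α : Type*) [Fintype α] [DecidableEq α] (r m d : ℕ) :
    Finset (Fin r → α → Fin m) :=
  (Fintype.piFinset fun _ => balancedFunctions α m d).filter
    fun f => Function.Injective fun a t => f t a

lemma card_simpleFamilies_le :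
    (simpleFamilies α r m d).card ≤ (balancedFunctions α m d).card ^ r := by
  refine (card_filter_le _ _).trans ?_
  simp

lemma card_le_card_simpleFamilies_add (hα : Fintype.card α = m * d) :
    m ^ r * (balancedFunctions α m d).card ^ r
      ≤ m ^ r * (simpleFamilies α r m d).card
        + (m * d) ^ 2 * (balancedFunctions α m d).card ^ r := by
  set B := balancedFunctions α m d
  set S := Fintype.piFinset fun _ : Fin r => B
  have hsub : S.filter (fun f => ¬ Function.Injective fun a t => f t a) ⊆
      (univ : Finset α).offDiag.biUnion fun p =>
        Fintype.piFinset fun _ : Fin r => B.filter fun f => f p.1 = f p.2 := by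
    intro f hf
    rw [mem_filter, Function.not_injective_iff] at hf
    obtain ⟨hfS, a, b, hfab, hab⟩ := hf
    refine mem_biUnion.2 ⟨(a, b), by simpa using hab, ?_⟩
    exact Fintype.mem_piFinset.2 fun t =>
      mem_filter.2 ⟨Fintype.mem_piFinset.1 hfS t, congrFun hfab t⟩
  have hcoll : m ^ r * (S.filter fun f => ¬ Function.Injective fun a t => f t a).card
      ≤ (m * d) ^ 2 * B.card ^ r := by
    calc _ ≤ m ^ r * ∑ p ∈ (univ : Finset α).offDiag,
          (B.filter fun f => f p.1 = f p.2).card ^ r := by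
          gcongr
          refine (card_le_card hsub).trans (card_biUnion_le.trans ?_)
          simp
      _ = ∑ p ∈ (univ : Finset α).offDiag,
          (m * (B.filter fun f => f p.1 = f p.2).card) ^ r := by
          simp only [mul_sum, mul_pow]
      _ ≤ ∑ p ∈ (univ : Finset α).offDiag, B.card ^ r := by
          refine sum_le_sum fun p hp => ?_
          gcongr
          exact card_collision_mul_le hα (mem_offDiag.1 hp).2.2
      _ ≤ _ := by
          rw [sum_const, smul_eq_mul, offDiag_card, card_univ, hα, sq]
          gcongr
          exact Nat.sub_le _ _
  have hS : S.card = B.card ^ r := by simp [S]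
  have hsplit := card_filter_add_card_filter_not (s := S)
    (fun f => Function.Injective fun a t => f t a)
  rw [← hS, ← hsplit, mul_add, hsplit, hS]
  exact Nat.add_le_add_left hcoll _

lemma card_eq_of_regular (t : Fin r) {E : Finset (Fin r → Fin m)}
    (hE : ∀ v, (E.filter fun e => e t = v).card = d) : E.card = m * d := by
  rw [card_eq_sum_card_fiberwise (f := fun e => e t) (t := univ) (by simp)]
  simp [hE]

lemma card_simpleFamilies (hr : 0 < r) (hα : Fintype.card α = m * d) :
    (simpleFamilies α r m d).card = Hcount r m d * (m * d)! := by
  classical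
  let P : Finset (Fin r → Fin m) → Prop := fun E => ∀ t v, (E.filter fun e => e t = v).card = d
  let F : (Σ E : {E // P E}, α ≃ E.1) → (Fin r → α → Fin m) := fun x t a => (x.2 a).1 t
  have hF : Function.Injective F := by
    rintro ⟨⟨E, hE⟩, e⟩ ⟨⟨E', hE'⟩, e'⟩ h
    have hval : ∀ a, (e a).1 = (e' a).1 := fun a => funext fun t => congrFun (congrFun h t) a
    obtain rfl : E = E' := by
      ext x
      constructor
      · intro hx
        have := hval (e.symm ⟨x, hx⟩)
        rw [Equiv.apply_symm_apply] at this
        exact (congrArg (· ∈ E') this).mpr (e' _).2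
      · intro hx
        have := hval (e'.symm ⟨x, hx⟩)
        rw [Equiv.apply_symm_apply] at this
        exact (congrArg (· ∈ E) this).mp (e _).2
    obtain rfl : e = e' := Equiv.ext fun a => Subtype.ext (hval a)
    rfl
  have himage : univ.image F = simpleFamilies α r m d := by
    ext f
    simp only [mem_image, mem_univ, true_and, simpleFamilies, mem_filter, Fintype.mem_piFinset,
      mem_balancedFunctions]
    constructor
    · rintro ⟨⟨⟨E, hE⟩, e⟩, rfl⟩
      refine ⟨fun t v => ?_, fun a b hab => e.injective (Subtype.ext hab)⟩
      rw [← hE t v]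
      refine card_bij (fun a _ => (e a).1) ?_ ?_ ?_
      · intro a ha
        simpa [F] using ha
      · intro a _ b _ hab
        exact e.injective (Subtype.ext hab)
      · intro x hx
        rw [mem_filter] at hx
        exact ⟨e.symm ⟨x, hx.1⟩, by simpa [F] using hx.2, by simp⟩
    · rintro ⟨hbal, hinj⟩
      let g : α ↪ (Fin r → Fin m) := ⟨fun a t => f t a, hinj⟩
      have hP : P (univ.map g) := by
        intro t v
        rw [filter_map, card_map, ← hbal t v]
        rfl
      let e : α ≃ (univ.map g : Finset (Fin r → Fin m)) :=
        Equiv.ofBijective (fun a => ⟨g a, mem_map_of_mem g (mem_univ a)⟩)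
          ⟨fun a b hab => g.injective (congrArg Subtype.val hab), by
            rintro ⟨x, hx⟩
            obtain ⟨a, -, rfl⟩ := mem_map.1 hx
            exact ⟨a, rfl⟩⟩
      exact ⟨⟨⟨_, hP⟩, e⟩, rfl⟩
  rw [← himage, card_image_of_injective _ hF, card_univ, Fintype.card_sigma, Hcount,
    Nat.card_eq_fintype_card, ← hα]
  have hequiv (E : {E // P E}) : Fintype.card (α ≃ E.1) = (Fintype.card α)! :=
    Fintype.card_equiv (Fintype.equivOfCardEq (by
      rw [hα, Fintype.card_coe, card_eq_of_regular ⟨0, hr⟩ (E.2 _)]))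
  simp only [hequiv, sum_const, card_univ, smul_eq_mul]
  rfl

end Counting

section Estimates

open scoped Nat

lemma descFactorial_div_pow_le_one (N k : ℕ) : (N.descFactorial k : ℝ) / (N : ℝ) ^ k ≤ 1 :=
  div_le_one_of_le₀ (mod_cast Nat.descFactorial_le_pow N k) (by positivity)

lemma one_sub_sq_div_le_descFactorial_div_pow {N : ℕ} (hN : 0 < N) (k : ℕ) :
    1 - (k : ℝ) ^ 2 / N ≤ (N.descFactorial k : ℝ) / (N : ℝ) ^ k := by
  have hN' : (0 : ℝ) < N := mod_cast hN
  induction k with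
  | zero => simp
  | succ k ih =>
    rcases le_or_gt (k + 1) N with hk | hk
    · have hle : (k : ℝ) + 1 ≤ N := mod_cast hk
      have hfac : ((N.descFactorial (k + 1) : ℕ) : ℝ) / (N : ℝ) ^ (k + 1)
          = (1 - k / N) * ((N.descFactorial k : ℝ) / (N : ℝ) ^ k) := by
        rw [Nat.descFactorial_succ, Nat.cast_mul, Nat.cast_sub (by omega)]
        field_simp
        ring
      have hx : (k : ℝ) / N ≤ 1 := by
        rw [div_le_one hN']
        linarith
      have hy : 0 ≤ (k : ℝ) / N := by positivity
      have hz : 0 ≤ 1 / (N : ℝ) := by positivity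
      rw [hfac]
      refine le_trans ?_ (mul_le_mul_of_nonneg_left ih (sub_nonneg.2 hx))
      have hexp : ((k + 1 : ℕ) : ℝ) ^ 2 / N = (k : ℝ) ^ 2 / N + 2 * (k / N) + 1 / N := by
        push_cast
        ring
      have hsq : 0 ≤ (k : ℝ) / N * ((k : ℝ) ^ 2 / N) := by positivity
      rw [hexp]
      nlinarith
    · have hle : (N : ℝ) ≤ ((k + 1 : ℕ) : ℝ) := mod_cast hk.le
      have h1 : (1 : ℝ) ≤ ((k + 1 : ℕ) : ℝ) := by
        push_cast
        linarith [(Nat.cast_nonneg k : (0 : ℝ) ≤ k)]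
      have : 1 ≤ ((k + 1 : ℕ) : ℝ) ^ 2 / N := by
        rw [one_le_div hN']
        nlinarith
      exact (sub_nonpos.2 this).trans (by positivity)

lemma one_sub_mul_le_descFactorial_div_pow_pow {N : ℕ} (hN : 0 < N) (k n : ℕ) :
    1 - n * ((k : ℝ) ^ 2 / N) ≤ ((N.descFactorial k : ℝ) / (N : ℝ) ^ k) ^ n := by
  have h := one_sub_sq_div_le_descFactorial_div_pow hN k
  have h0 : 0 ≤ (N.descFactorial k : ℝ) / (N : ℝ) ^ k := by positivity
  refine le_trans ?_ (one_add_mul_sub_le_pow (by linarith) n)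
  have := mul_le_mul_of_nonneg_left h (Nat.cast_nonneg n : (0 : ℝ) ≤ n)
  linarith

/-- The proportion of families of `r` balanced functions which have no repeated edge. -/
noncomputable def simpleProportion (r m d : ℕ) : ℝ :=
  (simpleFamilies (Fin m × Fin d) r m d).card /
    ((balancedFunctions (Fin m × Fin d) m d).card : ℝ) ^ r

lemma card_balancedFunctions_pos (m d : ℕ) :
    0 < (balancedFunctions (Fin m × Fin d) m d).card :=
  Finset.card_pos.2 ⟨_, fst_mem_balancedFunctions⟩

lemma simpleProportion_le_one (r m d : ℕ) : simpleProportion r m d ≤ 1 :=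
  div_le_one_of_le₀ (mod_cast card_simpleFamilies_le) (by positivity)

lemma one_sub_le_simpleProportion {r m d : ℕ} (hm : 0 < m) :
    1 - ((m * d : ℕ) : ℝ) ^ 2 / (m : ℝ) ^ r ≤ simpleProportion r m d := by
  have hT : (0 : ℝ) < (balancedFunctions (Fin m × Fin d) m d).card :=
    mod_cast card_balancedFunctions_pos m d
  have hm' : (0 : ℝ) < m := mod_cast hm
  have h : ((m ^ r * (balancedFunctions (Fin m × Fin d) m d).card ^ r : ℕ) : ℝ) ≤ _ :=
    Nat.cast_le.2 (card_le_card_simpleFamilies_add (r := r) (by simp))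
  push_cast at h
  rw [simpleProportion, le_div_iff₀ (by positivity), sub_mul, one_mul, sub_le_iff_le_add]
  refine le_of_mul_le_mul_left ?_ (show 0 < (m : ℝ) ^ r by positivity)
  refine h.trans_eq ?_
  push_cast
  field_simp

lemma Hcount_div_Hhat {r m d : ℕ} (hr : 0 < r) (hm : 0 < m) :
    (Hcount r m d : ℝ) / Hhat r m d = simpleProportion r m d *
      (((m ^ r).descFactorial (m * d) : ℝ) / ((m ^ r : ℕ) : ℝ) ^ (m * d)) ^ (r - 1) /
      (((m ^ (r - 1)).descFactorial d : ℝ) / ((m ^ (r - 1) : ℕ) : ℝ) ^ d) ^ (r * m) := by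
  obtain ⟨s, rfl⟩ : ∃ s, r = s + 1 := ⟨r - 1, by omega⟩
  have hm' : (m : ℝ) ≠ 0 := by positivity
  have hT : ((balancedFunctions (Fin m × Fin d) m d).card : ℝ) = (m * d)! / (d ! : ℝ) ^ m := by
    rw [eq_div_iff (by positivity)]
    exact_mod_cast card_balancedFunctions_mul
  have hS : ((simpleFamilies (Fin m × Fin d) (s + 1) m d).card : ℝ)
      = Hcount (s + 1) m d * (m * d)! := by
    exact_mod_cast card_simpleFamilies hr (by simp)
  have hc (n k : ℕ) : (n.choose k : ℝ) = n.descFactorial k / k ! := by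
    rw [eq_div_iff (by positivity), mul_comm]
    exact_mod_cast (Nat.descFactorial_eq_factorial_mul_choose n k).symm
  have hpow : (((m : ℝ) ^ (s + 1)) ^ (m * d)) ^ s = (((m : ℝ) ^ s) ^ d) ^ ((s + 1) * m) := by
    simp only [← pow_mul]
    ring
  have hfac : ((m * d)! : ℝ) ≠ 0 := by positivity
  have hfac' : (d ! : ℝ) ≠ 0 := by positivity
  simp only [Hhat, simpleProportion, hT, hS, hc, Nat.add_sub_cancel, Nat.cast_pow, div_pow, hpow]
  rw [show ((d ! : ℝ) ^ m) ^ (s + 1) = (d ! : ℝ) ^ ((s + 1) * m) by rw [← pow_mul, mul_comm],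
    pow_succ ((m * d)! : ℝ) s]
  have hM : (((m : ℝ) ^ s) ^ d) ^ ((s + 1) * m) ≠ 0 := by positivity
  generalize (((m : ℝ) ^ s) ^ d) ^ ((s + 1) * m) = M at hM ⊢
  simp only [div_eq_mul_inv, mul_inv, inv_inv]
  field_simp

end Estimates

/-- if `n = r(n)·m(n) → ∞`, `r ≥ 3`, `m ≥ 1`, `d ≥ 0` and
`r·d² = o(m^(r-2))`, then `H_r(d,m) = (1+o(1))·Ĥ_r(d,m)`. -/
theorem regular_multipartite_hypergraph_count_sparse
    (r m d : ℕ → ℕ)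
    (hr : ∀ k, 3 ≤ r k) (hm : ∀ k, 1 ≤ m k)
    (hn : Tendsto (fun k => r k * m k) atTop atTop)
    (ho : (fun k => (r k : ℝ) * (d k : ℝ) ^ 2) =o[atTop]
      (fun k => (m k : ℝ) ^ (r k - 2))) :
    Tendsto (fun k => (Hcount (r k) (m k) (d k) : ℝ) / Hhat (r k) (m k) (d k))
      atTop (nhds 1) := by
  set ε : ℕ → ℝ := fun k => (r k : ℝ) * (d k : ℝ) ^ 2 / (m k : ℝ) ^ (r k - 2) with hε
  have hε0 : Tendsto (fun k => 1 - ε k) atTop (nhds 1) := by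
    simpa using ho.tendsto_div_nhds_zero.const_sub 1
  have hmR (k : ℕ) : (0 : ℝ) < m k := mod_cast hm k
  have hcollision (k : ℕ) : ((m k * d k : ℕ) : ℝ) ^ 2 / (m k : ℝ) ^ r k
      = (d k : ℝ) ^ 2 / (m k : ℝ) ^ (r k - 2) := by
    obtain ⟨s, hs⟩ : ∃ s, r k = s + 2 := ⟨r k - 2, by have := hr k; omega⟩
    have := (hmR k).ne'
    rw [hs, Nat.add_sub_cancel, pow_add]
    push_cast
    field_simp
  have hP : Tendsto (fun k => simpleProportion (r k) (m k) (d k)) atTop (nhds 1) := by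
    refine tendsto_of_tendsto_of_tendsto_of_le_of_le hε0 tendsto_const_nhds (fun k => ?_)
      fun k => simpleProportion_le_one _ _ _
    refine le_trans ?_ (one_sub_le_simpleProportion (hm k))
    have hrk : (1 : ℝ) ≤ r k := mod_cast (by have := hr k; omega : 1 ≤ r k)
    rw [hcollision, sub_le_sub_iff_left, hε]
    have := hmR k
    dsimp only
    gcongr
    exact le_mul_of_one_le_left (by positivity) hrk
  have hedges : Tendsto (fun k => (((m k ^ r k).descFactorial (m k * d k) : ℝ) /
      ((m k ^ r k : ℕ) : ℝ) ^ (m k * d k)) ^ (r k - 1)) atTop (nhds 1) := by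
    refine tendsto_of_tendsto_of_tendsto_of_le_of_le hε0 tendsto_const_nhds (fun k => ?_)
      fun k => pow_le_one₀ (by positivity) (descFactorial_div_pow_le_one _ _)
    refine le_trans ?_ (one_sub_mul_le_descFactorial_div_pow_pow (pow_pos (hm k) _) _ _)
    rw [Nat.cast_pow (m k), hcollision, sub_le_sub_iff_left, hε]
    have := hmR k
    dsimp only
    rw [mul_div_assoc]
    gcongr
    exact Nat.sub_le _ _
  have hlinks : Tendsto (fun k => (((m k ^ (r k - 1)).descFactorial (d k) : ℝ) /
      ((m k ^ (r k - 1) : ℕ) : ℝ) ^ d k) ^ (r k * m k)) atTop (nhds 1) := by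
    refine tendsto_of_tendsto_of_tendsto_of_le_of_le hε0 tendsto_const_nhds (fun k => ?_)
      fun k => pow_le_one₀ (by positivity) (descFactorial_div_pow_le_one _ _)
    refine le_trans (le_of_eq ?_)
      (one_sub_mul_le_descFactorial_div_pow_pow (pow_pos (hm k) _) _ _)
    obtain ⟨s, hs⟩ : ∃ s, r k = s + 2 := ⟨r k - 2, by have := hr k; omega⟩
    have := (hmR k).ne'
    simp only [hε, hs, Nat.add_sub_cancel, show s + 2 - 1 = s + 1 by omega, pow_succ]
    push_cast
    field_simp
  have hlim := (hP.mul hedges).div hlinks one_ne_zero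
  rw [mul_one, div_one] at hlim
  exact hlim.congr fun k =>
    (Hcount_div_Hhat (by have := hr k; omega) (hm k)).symm
end
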